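/- arXiv:1602.01706 — 4 statements merged into one kernel-verified Lean document; each statement's English description precedes it below -/
import Mathlib

section
/- For every integer r ≥ 2 and every x ∈ ℂ∖ℤ, with t = e^{2πix}, one has h_r(t) = (r−1)!·(−1/(2πi))^r · Σ_{n∈ℤ} 1/(x+n)^r, where the series over n ∈ ℤ converges absolutely. -/
/-- The auxiliary functions `h_r : ℂ ∖ {1} → ℂ` of Kato–Kurokawa–Saito:
`h 1 t = (1+t)/(2(1-t))` and `h (r+1) t = t * (h r)'(t)`. (`auxH 0` is junk.) -/
noncomputable def auxH : ℕ → ℂ → ℂ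
  | 0 => fun _ => 0
  | 1 => fun t => (1 + t) / (2 * (1 - t))
  | (n + 2) => fun t => t * deriv (auxH (n + 1)) t


open Complex in
lemma aux_ball {x : ℂ} (hx : x ∈ integerComplement) : ∃ δ > 0, ∀ z ∈ Metric.ball x δ,
    z ∈ integerComplement ∧ ∀ n : ℤ, ‖x + n‖ / 2 ≤ ‖z + n‖ ∧ ‖z + n‖ ≤ 2 * ‖x + n‖ := by
  obtain ⟨ε, hε, h⟩ := Metric.isOpen_iff.1 (Complex.isOpen_compl_range_intCast) x hx
  have hn : ∀ n : ℤ, ε ≤ ‖x + n‖ := by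
    intro n
    by_contra! hlt
    have : ((-n : ℤ) : ℂ) ∈ Metric.ball x ε := by
      rw [Metric.mem_ball, dist_comm, dist_eq_norm]
      simpa using hlt
    exact h this ⟨-n, rfl⟩
  refine ⟨ε / 2, by positivity, fun z hz => ⟨h (Metric.ball_subset_ball (by linarith) hz), fun n => ?_⟩⟩
  have h1 := hn n
  rw [Metric.mem_ball, dist_eq_norm] at hz
  have h2 : ‖x + n‖ ≤ ‖z + n‖ + ‖z - x‖ := by
    have := norm_sub_le (z + n) (z - x)
    rwa [show z + n - (z - x) = x + n by ring] at this
  have h3 : ‖z + n‖ ≤ ‖x + n‖ + ‖z - x‖ := by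
    have := norm_add_le (x + n) (z - x)
    rwa [show x + n + (z - x) = z + n by ring] at this
  constructor <;> linarith

lemma aux_summable (x : ℂ) (r : ℕ) (hr : 2 ≤ r) : Summable (fun n : ℤ => 1 / (x + (n : ℂ)) ^ r) := by
  have := EisensteinSeries.linear_right_summable x 1 (k := r) (by exact_mod_cast hr)
  simpa using this

open Complex in
lemma aux_term_deriv {x : ℂ} (a : ℂ) (h : x + a ≠ 0) (r : ℕ) :
    HasDerivAt (fun z : ℂ => 1 / (z + a) ^ r) (-r * (1 / (x + a) ^ (r + 1))) x := by
  have h1 : HasDerivAt (fun z : ℂ => (z + a) ^ r) (r * (x + a) ^ (r - 1) * 1) x :=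
    ((hasDerivAt_id x).add_const a).pow r
  have h2 := h1.inv (pow_ne_zero r h)
  simp only [one_div]
  convert! h2 using 1
  rcases r with _ | r
  · simp
  · simp only [Nat.add_sub_cancel]
    field_simp
    ring

open Complex in
lemma aux_deriv_pow {x : ℂ} (hx : x ∈ integerComplement) (r : ℕ) (hr : 2 ≤ r) :
    HasDerivAt (fun z : ℂ => ∑' n : ℤ, 1 / (z + (n : ℂ)) ^ r)
      (-r * ∑' n : ℤ, 1 / (x + (n : ℂ)) ^ (r + 1)) x := by
  obtain ⟨δ, hδ, hb⟩ := aux_ball hx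
  have hu : Summable (fun n : ℤ => 2 ^ r * ‖1 / (x + (n : ℂ)) ^ r‖) :=
    (aux_summable x r hr).norm.mul_left _
  have hd : ∀ n : ℤ, DifferentiableOn ℂ (fun z : ℂ => 1 / (z + (n : ℂ)) ^ r) (Metric.ball x δ) :=
    fun n z hz => (aux_term_deriv (n : ℂ) (integerComplement_add_ne_zero (hb z hz).1 n)
      r).differentiableAt.differentiableWithinAt
  have hle : ∀ (n : ℤ) (w : ℂ), w ∈ Metric.ball x δ →
      ‖1 / (w + (n : ℂ)) ^ r‖ ≤ 2 ^ r * ‖1 / (x + (n : ℂ)) ^ r‖ := by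
    intro n w hw
    have h1 := ((hb w hw).2 n).1
    have h0 : 0 < ‖x + n‖ := norm_pos_iff.2 (integerComplement_add_ne_zero hx n)
    simp only [norm_div, norm_pow, norm_one]
    have : 2 ^ r * (1 / ‖x + n‖ ^ r) = 1 / (‖x + n‖ / 2) ^ r := by
      rw [div_pow]; field_simp
    rw [this]
    gcongr
  have hx' := Metric.mem_ball_self (x := x) hδ
  have hD := (Complex.differentiableOn_tsum_of_summable_norm hu hd Metric.isOpen_ball hle).differentiableAt
    (Metric.isOpen_ball.mem_nhds hx')
  have hS := Complex.hasSum_deriv_of_summable_norm hu hd Metric.isOpen_ball hle hx'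
  have := hS.tsum_eq
  convert! hD.hasDerivAt using 1
  rw [← this, ← tsum_mul_left]
  refine tsum_congr fun n => ?_
  rw [(aux_term_deriv (n : ℂ) (integerComplement_add_ne_zero hx n) r).deriv]

open Complex in
lemma aux_cotTerm_deriv {x : ℂ} (hx : x ∈ integerComplement) (n : ℕ) :
    HasDerivAt (fun z : ℂ => cotTerm z n)
      (-(1 / (x - (n + 1)) ^ 2 + 1 / (x + (n + 1)) ^ 2)) x := by
  have h1 := integerComplement_add_ne_zero hx (-(n + 1))
  have h2 := integerComplement_add_ne_zero hx (n + 1)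
  have := (aux_term_deriv _ h1 1).add (aux_term_deriv _ h2 1)
  convert! this using 1
  · ext z
    simp [cotTerm, sub_eq_add_neg]
  · push_cast
    ring

open Complex in
lemma aux_deriv_cot {x : ℂ} (hx : x ∈ integerComplement) :
    HasDerivAt (fun z : ℂ => (Real.pi : ℂ) * cot (Real.pi * z))
      (-∑' n : ℤ, 1 / (x + (n : ℂ)) ^ 2) x := by
  obtain ⟨δ, hδ, hb⟩ := aux_ball hx
  have hu : Summable (fun n : ℕ => 8 * ‖cotTerm x n‖) := (summable_cotTerm hx).norm.mul_left _
  have hd : ∀ n : ℕ, DifferentiableOn ℂ (fun z : ℂ => cotTerm z n) (Metric.ball x δ) :=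
    fun n z hz => (aux_cotTerm_deriv (hb z hz).1 n).differentiableAt.differentiableWithinAt
  have hle : ∀ (n : ℕ) (w : ℂ), w ∈ Metric.ball x δ → ‖cotTerm w n‖ ≤ 8 * ‖cotTerm x n‖ := by
    intro n w hw
    have h1 := ((hb w hw).2 (n + 1)).1
    have h2 := ((hb w hw).2 (-(n + 1))).1
    have h3 := ((hb w hw).2 0).2
    have p1 : 0 < ‖x + ((n + 1 : ℤ) : ℂ)‖ := norm_pos_iff.2 (integerComplement_add_ne_zero hx _)
    have p2 : 0 < ‖x + ((-(n + 1) : ℤ) : ℂ)‖ := norm_pos_iff.2 (integerComplement_add_ne_zero hx _)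
    push_cast at h1 h2 h3 p1 p2
    simp only [← sub_eq_add_neg, add_zero] at h1 h2 h3 p1 p2
    have e2 : ∀ y : ℂ, y + (-1 + -(n : ℂ)) = y - (n + 1) := fun y => by ring
    rw [cotTerm_identity hx, cotTerm_identity (hb w hw).1]
    simp only [norm_mul, norm_div, norm_one]
    have : 8 * (‖(2 : ℂ)‖ * ‖x‖ * (1 / (‖x + (n + 1)‖ * ‖x - (n + 1)‖))) =
      ‖(2 : ℂ)‖ * (2 * ‖x‖) * (1 / ((‖x + (n + 1)‖ / 2) * (‖x - (n + 1)‖ / 2))) := by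
      field_simp
      norm_num
      ring
    rw [this]
    gcongr
  have hx' := Metric.mem_ball_self (x := x) hδ
  have hD := (Complex.differentiableOn_tsum_of_summable_norm hu hd Metric.isOpen_ball hle).differentiableAt
    (Metric.isOpen_ball.mem_nhds hx')
  have hS := (Complex.hasSum_deriv_of_summable_norm hu hd Metric.isOpen_ball hle hx').tsum_eq
  have hinv := aux_term_deriv (x := x) 0 (by simpa using integerComplement.ne_zero hx) 1
  have hsum := hD.hasDerivAt.add hinv
  have hs := aux_summable x 2 le_rfl
  have hs1 : Summable (fun n : ℕ => 1 / (x + (n + 1)) ^ 2) := by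
    have := hs.comp_injective (i := fun n : ℕ => (n + 1 : ℤ)) (fun a b h => by simpa using h)
    simpa [Function.comp_def] using this
  have hs2 : Summable (fun n : ℕ => 1 / (x - (n + 1)) ^ 2) := by
    have := hs.comp_injective (i := fun n : ℕ => (-(n + 1) : ℤ)) (fun a b h => by simpa using h)
    refine this.congr fun n => ?_
    simp only [Function.comp_def]
    push_cast
    ring
  have hval : deriv (fun w : ℂ => ∑' i : ℕ, cotTerm w i) x + -((1 : ℕ) : ℂ) * (1 / (x + 0) ^ (1 + 1))
      = -∑' n : ℤ, 1 / (x + (n : ℂ)) ^ 2 := by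
    have hZ := (HasSum.of_add_one_of_neg_add_one (f := fun n : ℤ => 1 / (x + (n : ℂ)) ^ 2)
      (m := ∑' n : ℕ, 1 / (x + (n + 1)) ^ 2) (m' := ∑' n : ℕ, 1 / (x - (n + 1)) ^ 2)
      (by simpa using hs1.hasSum)
      (by
        refine hs2.hasSum.congr_fun ?_
        intro n
        push_cast
        ring)).tsum_eq
    rw [hZ, ← hS]
    simp_rw [fun n => (aux_cotTerm_deriv hx n).deriv]
    rw [tsum_neg, hs2.tsum_add hs1]
    push_cast
    ring
  rw [hval] at hsum
  refine hsum.congr_of_eventuallyEq ?_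
  filter_upwards [Metric.isOpen_ball.mem_nhds hx'] with z hz
  have := cot_series_rep' (hb z hz).1
  simp only [Pi.add_apply, cotTerm, ← this]
  simp

lemma auxH_diff (r : ℕ) : DifferentiableOn ℂ (auxH (r + 1)) {1}ᶜ := by
  induction r with
  | zero =>
    intro t ht
    have : 2 * (1 - t) ≠ 0 := mul_ne_zero two_ne_zero (sub_ne_zero.2 (fun h => ht h.symm))
    have : DifferentiableAt ℂ (fun t : ℂ => (1 + t) / (2 * (1 - t))) t := by fun_prop (disch := assumption)
    exact this.differentiableWithinAt
  | succ r ih =>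
    exact differentiableOn_id.mul (ih.deriv isOpen_compl_singleton)

open Complex in
lemma aux_exp_ne {x : ℂ} (hx : x ∈ integerComplement) : exp (2 * (Real.pi : ℂ) * I * x) ≠ 1 := by
  intro h
  obtain ⟨n, hn⟩ := Complex.exp_eq_one_iff.1 h
  refine hx ⟨n, ?_⟩
  have : (2 * (Real.pi : ℂ) * I) ≠ 0 := two_pi_I_ne_zero
  apply mul_left_cancel₀ this
  rw [hn]; ring

open Complex in
/-- chain rule step -/
lemma aux_step {x : ℂ} (hx : x ∈ integerComplement) (r : ℕ) {D : ℂ}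
    (h : HasDerivAt (fun z => auxH (r + 1) (exp (2 * (Real.pi : ℂ) * I * z))) D x) :
    auxH (r + 2) (exp (2 * (Real.pi : ℂ) * I * x)) = D / (2 * (Real.pi : ℂ) * I) := by
  have h1 : HasDerivAt (fun z => exp (2 * (Real.pi : ℂ) * I * z))
      (exp (2 * (Real.pi : ℂ) * I * x) * (2 * (Real.pi : ℂ) * I)) x := by
    simpa using ((hasDerivAt_id x).const_mul (2 * (Real.pi : ℂ) * I)).cexp
  have h2 := ((auxH_diff r).differentiableAt (isOpen_compl_singleton.mem_nhds
    (aux_exp_ne hx))).hasDerivAt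
  have h3 := h.unique (h2.comp x h1)
  rw [h3, eq_div_iff two_pi_I_ne_zero]
  simp only [auxH]
  ring

open Complex in
lemma aux_main (r : ℕ) : ∀ x ∈ integerComplement,
    auxH (r + 2) (exp (2 * (Real.pi : ℂ) * I * x)) =
      (Nat.factorial (r + 1) : ℂ) * (-1 / (2 * (Real.pi : ℂ) * I)) ^ (r + 2) *
        ∑' n : ℤ, 1 / (x + (n : ℂ)) ^ (r + 2) := by
  have hpi : (Real.pi : ℂ) ≠ 0 := ofReal_ne_zero.2 Real.pi_ne_zero
  induction r with
  | zero =>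
    intro x hx
    have h := (aux_deriv_cot hx).const_mul (I / (2 * Real.pi))
    rw [aux_step hx 0 (D := I / (2 * Real.pi) * (-∑' n : ℤ, 1 / (x + (n : ℂ)) ^ 2))]
    · simp only [zero_add, Nat.factorial_one, Nat.cast_one]
      generalize (∑' n : ℤ, 1 / (x + (n : ℂ)) ^ 2) = S
      field_simp
      simp
    · refine h.congr_of_eventuallyEq (Filter.Eventually.of_forall fun z => ?_)
      simp only [auxH, zero_add, cot_pi_eq_exp_ratio]
      generalize exp (2 * (Real.pi : ℂ) * I * z) = t
      by_cases ht : 1 - t = 0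
      · simp [ht]
      · field_simp
        ring
  | succ r ih =>
    intro x hx
    have h := (aux_deriv_pow hx (r + 2) (by omega)).const_mul
      ((Nat.factorial (r + 1) : ℂ) * (-1 / (2 * (Real.pi : ℂ) * I)) ^ (r + 2))
    rw [aux_step hx (r + 1) (h.congr_of_eventuallyEq ?_)]
    · rw [Nat.factorial_succ (r + 1), pow_succ _ (r + 2)]
      push_cast
      ring
    · filter_upwards [Complex.isOpen_compl_range_intCast.mem_nhds hx] with z hz
      exact ih z hz

theorem auxH_eq_tsum (r : ℕ) (hr : 2 ≤ r) (x : ℂ) (hx : ∀ n : ℤ, x ≠ (n : ℂ)) :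
    Summable (fun n : ℤ => ‖1 / (x + (n : ℂ)) ^ r‖) ∧
    auxH r (Complex.exp (2 * (Real.pi : ℂ) * Complex.I * x)) =
      (Nat.factorial (r - 1) : ℂ) * (-1 / (2 * (Real.pi : ℂ) * Complex.I)) ^ r *
        ∑' n : ℤ, 1 / (x + (n : ℂ)) ^ r := by
  refine ⟨(aux_summable x r hr).norm, ?_⟩
  obtain ⟨k, rfl⟩ := Nat.exists_eq_add_of_le' hr
  exact aux_main k x (fun ⟨n, hn⟩ => hx n hn.symm)
end

section
/- Let q ≥ 2 and p ≥ 1 be integers, set N = 2q and r = 2p+1, let ζ_{2q} = e^{2πi/(2q)}, and let χ : ℤ → ℂ be a symmetric function mod 2q of parity r. Then L(r,χ) = Σ_{n=1}^∞ χ(n)/n^r = ((−1)^{p+1}/(r−1)!)·(π^r i / q^r) · Σ_{a=1}^{q−1} χ(a)·h_r(ζ_{2q}^a). -/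
/-- A symmetric function mod `N` of parity `r`: `χ (k*N) = 0`, `χ` is `N`-periodic,
and `χ (N - a) = (-1)^r * χ a` for `1 ≤ a ≤ N-1`. -/
def IsSymmetricFun (N r : ℕ) (χ : ℤ → ℂ) : Prop :=
  (∀ k : ℤ, χ (k * N) = 0) ∧
  (∀ k : ℤ, ∀ a : ℕ, 1 ≤ a → a ≤ N - 1 → χ (k * N + a) = χ a) ∧
  (∀ a : ℕ, 1 ≤ a → a ≤ N - 1 → χ ((N : ℤ) - a) = (-1) ^ r * χ a)

open Filter Topology in
lemma auxH_analytic (k : ℕ) : AnalyticOnNhd ℂ (auxH (k + 1)) {1}ᶜ := by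
  induction k with
  | zero =>
    intro t ht
    have h : (2 * (1 - t)) ≠ 0 := by
      exact mul_ne_zero two_ne_zero (sub_ne_zero.2 (Ne.symm ht))
    have : auxH (0 + 1) = fun t => (1 + t) / (2 * (1 - t)) := by
      simp [auxH]
    rw [this]
    have h1 : AnalyticAt ℂ (fun t : ℂ => 1 + t) t := by fun_prop
    have h2 : AnalyticAt ℂ (fun t : ℂ => 2 * (1 - t)) t := by fun_prop
    exact h1.div h2 h
  | succ k ih =>
    intro t ht
    have : auxH (k + 1 + 1) = fun t => t * deriv (auxH (k + 1)) t := by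
      simp [auxH]
    rw [this]
    exact analyticAt_id.mul (ih t ht).deriv

lemma exp_uhp_ne_one {z : ℂ} (hz : 0 < z.im) :
    Complex.exp (2 * (Real.pi : ℂ) * Complex.I * z) ≠ 1 := by
  intro h
  have := congrArg norm h
  rw [Complex.norm_exp] at this
  simp at this
  have hz0 := hz.ne'
  have hpi := Real.pi_ne_zero
  simp_all

lemma iter_cot (k : ℕ) : ∀ z ∈ UpperHalfPlane.upperHalfPlaneSet,
    iteratedDerivWithin k (fun x : ℂ ↦ (Real.pi : ℂ) * Complex.cot (Real.pi * x))
      UpperHalfPlane.upperHalfPlaneSet z =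
    (2 * Real.pi / Complex.I) * (2 * Real.pi * Complex.I) ^ k *
      auxH (k + 1) (Complex.exp (2 * (Real.pi : ℂ) * Complex.I * z)) := by
  induction k with
  | zero =>
    intro z hz
    have h1 := exp_uhp_ne_one hz
    rw [iteratedDerivWithin_zero, Complex.cot_pi_eq_exp_ratio]
    simp only [auxH]
    generalize Complex.exp (2 * (Real.pi : ℂ) * Complex.I * z) = t at *
    have : (1 - t) ≠ 0 := sub_ne_zero.2 h1.symm
    have hI := Complex.I_ne_zero
    field_simp
    ring
  | succ k ih =>
    intro z hz
    have hopen : IsOpen UpperHalfPlane.upperHalfPlaneSet :=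
      UpperHalfPlane.isOpen_upperHalfPlaneSet
    rw [iteratedDerivWithin_succ, derivWithin_congr ih (ih z hz),
      derivWithin_of_isOpen hopen hz]
    have hA := (auxH_analytic k _ (exp_uhp_ne_one hz)).differentiableAt.hasDerivAt
    have he : HasDerivAt (fun z : ℂ => Complex.exp (2 * (Real.pi : ℂ) * Complex.I * z))
        (Complex.exp (2 * (Real.pi : ℂ) * Complex.I * z) * (2 * (Real.pi : ℂ) * Complex.I)) z := by
      simpa using ((hasDerivAt_id z).const_mul (2 * (Real.pi : ℂ) * Complex.I)).cexp
    have := ((hA.comp z he).const_mul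
      ((2 * Real.pi / Complex.I) * (2 * Real.pi * Complex.I) ^ k)).deriv
    simp only [Function.comp_def] at this
    rw [this]
    simp only [auxH]
    ring

open Filter Topology in
lemma key (p : ℕ) (hp : 1 ≤ p) (x : ℝ) (hx : ∀ n : ℤ, x + n ≠ 0) :
    (2 * Real.pi / Complex.I) * (2 * Real.pi * Complex.I) ^ (2 * p) *
      auxH (2 * p + 1) (Complex.exp (2 * (Real.pi : ℂ) * Complex.I * x)) =
    (Nat.factorial (2 * p) : ℂ) * ∑' n : ℤ, 1 / ((x : ℂ) + n) ^ (2 * p + 1) := by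
  have hne : Complex.exp (2 * (Real.pi : ℂ) * Complex.I * x) ≠ 1 := by
    intro h
    rw [Complex.exp_eq_one_iff] at h
    obtain ⟨n, hn⟩ := h
    have h2 := Complex.two_pi_I_ne_zero
    have : (x : ℂ) = n := by
      apply mul_left_cancel₀ h2; rw [hn]; ring
    have : x = n := by exact_mod_cast this
    apply hx (-n)
    simp [this]
  have hz : Tendsto (fun y : ℝ => (x : ℂ) + y * Complex.I) (𝓝[>] 0) (𝓝 (x : ℂ)) := by
    have : ContinuousAt (fun y : ℝ => (x : ℂ) + y * Complex.I) 0 := by fun_prop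
    have h := this.tendsto
    simp only [Complex.ofReal_zero, zero_mul, add_zero] at h
    exact h.mono_left nhdsWithin_le_nhds
  have hL : Tendsto (fun y : ℝ => (2 * Real.pi / Complex.I) * (2 * Real.pi * Complex.I) ^ (2 * p) *
      auxH (2 * p + 1) (Complex.exp (2 * (Real.pi : ℂ) * Complex.I * ((x : ℂ) + y * Complex.I))))
      (𝓝[>] 0) (𝓝 ((2 * Real.pi / Complex.I) * (2 * Real.pi * Complex.I) ^ (2 * p) *
      auxH (2 * p + 1) (Complex.exp (2 * (Real.pi : ℂ) * Complex.I * x)))) := by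
    apply Tendsto.const_mul
    have h1 := (auxH_analytic (2 * p) _ hne).continuousAt.tendsto
    have h2 : Tendsto (fun y : ℝ => Complex.exp
        (2 * (Real.pi : ℂ) * Complex.I * ((x : ℂ) + y * Complex.I))) (𝓝[>] 0)
        (𝓝 (Complex.exp (2 * (Real.pi : ℂ) * Complex.I * x))) :=
      (Complex.continuous_exp.tendsto _).comp (hz.const_mul _)
    exact h1.comp h2
  have hR : Tendsto (fun y : ℝ => ∑' n : ℤ, 1 / (((x : ℂ) + y * Complex.I) + n) ^ (2 * p + 1))
      (𝓝[>] 0) (𝓝 (∑' n : ℤ, 1 / ((x : ℂ) + n) ^ (2 * p + 1))) := by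
    have hs : Summable (fun n : ℤ => 1 / |(n : ℝ) + x| ^ (2 * p + 1)) := by
      have := (Real.summable_one_div_int_add_rpow x ((2 * p + 1 : ℕ) : ℝ)).2 (by
        exact_mod_cast (by omega : 1 < 2 * p + 1))
      simpa only [Real.rpow_natCast] using this
    apply tendsto_tsum_of_dominated_convergence hs
    · intro n
      have hnz : ((x : ℂ) + n) ^ (2 * p + 1) ≠ 0 := by
        apply pow_ne_zero
        exact_mod_cast hx n
      exact tendsto_const_nhds.div ((hz.add_const _).pow _) hnz
    · refine Eventually.of_forall fun y n => ?_
      rw [norm_div, norm_pow, norm_one]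
      have hpos : 0 < |(n : ℝ) + x| := abs_pos.2 (by rw [add_comm]; exact hx n)
      have hle : |(n : ℝ) + x| ≤ ‖(x : ℂ) + y * Complex.I + n‖ := by
        have := Complex.abs_re_le_norm ((x : ℂ) + y * Complex.I + n)
        simpa [add_comm] using this
      gcongr
  refine tendsto_nhds_unique hL ((hR.const_mul _).congr' ?_)
  filter_upwards [self_mem_nhdsWithin] with y hy
  have hm : (x : ℂ) + y * Complex.I ∈ UpperHalfPlane.upperHalfPlaneSet := by
    change 0 < ((x : ℂ) + y * Complex.I).im
    simpa using hy
  rw [← iter_cot (2 * p) _ hm,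
    iteratedDerivWithin_cot_pi_mul_eq_mul_tsum_div_pow (by omega) hm]
  simp

lemma chi_per {N r : ℕ} (χ : ℤ → ℂ) (h : IsSymmetricFun N r χ) (k : ℤ) (a : ℕ) (ha : a < N) :
    χ (k * N + a) = χ a := by
  rcases Nat.eq_zero_or_pos a with rfl | h0
  · have h1 := h.1 k
    have h2 := h.1 0
    simp at h2
    simp [h1, h2]
  · exact h.2.1 k a h0 (by omega)

lemma chi_neg {N r : ℕ} (hN : 0 < N) (χ : ℤ → ℂ) (h : IsSymmetricFun N r χ) (n : ℤ) :
    χ (-n) = (-1) ^ r * χ n := by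
  have hn := Int.ediv_mul_add_emod n N
  obtain ⟨a, ha⟩ := Int.eq_ofNat_of_zero_le (Int.emod_nonneg n (b := N) (by omega))
  have hlt := Int.emod_lt_of_pos n (b := N) (by omega)
  rw [ha] at hn hlt
  have haN : a < N := by exact_mod_cast hlt
  rw [← hn, chi_per χ h _ a haN]
  rcases Nat.eq_zero_or_pos a with rfl | h0
  · have h1 := h.1 (-(n / N))
    have h2 := h.1 0
    simp at h2 h1
    simp [h1, h2]
  · rw [← h.2.2 a h0 (by omega)]
    have e1 : -(n / (N : ℤ) * N + a) = (-(n / (N : ℤ)) - 1) * N + ((N - a : ℕ) : ℤ) := by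
      push_cast [haN.le]; ring
    rw [e1, chi_per χ h _ (N - a) (by omega)]
    push_cast [haN.le]; rfl

lemma chi_bdd {N r : ℕ} (hN : 0 < N) (χ : ℤ → ℂ) (h : IsSymmetricFun N r χ) (n : ℤ) :
    ‖χ n‖ ≤ ∑ a ∈ Finset.range N, ‖χ (a : ℤ)‖ := by
  have hn := Int.ediv_mul_add_emod n N
  obtain ⟨a, ha⟩ := Int.eq_ofNat_of_zero_le (Int.emod_nonneg n (b := N) (by omega))
  have hlt := Int.emod_lt_of_pos n (b := N) (by omega)
  rw [ha] at hn hlt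
  have haN : a < N := by exact_mod_cast hlt
  rw [← hn, chi_per χ h _ a haN]
  exact Finset.single_le_sum (f := fun a : ℕ => ‖χ (a : ℤ)‖) (fun _ _ => norm_nonneg _)
    (Finset.mem_range.2 haN)

lemma summ_f {N r : ℕ} (hN : 0 < N) (hr : 1 < r) (χ : ℤ → ℂ) (h : IsSymmetricFun N r χ) :
    Summable (fun n : ℤ => χ n / (n : ℂ) ^ r) := by
  have := (Real.summable_one_div_int_pow.2 hr).norm.mul_left (∑ a ∈ Finset.range N, ‖χ (a : ℤ)‖)
  refine Summable.of_norm_bounded this fun n => ?_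
  rw [norm_div, div_eq_mul_one_div]
  have e : 1 / ‖(n : ℂ) ^ r‖ = ‖1 / (n : ℝ) ^ r‖ := by simp
  rw [e]
  gcongr
  exact chi_bdd hN χ h n

lemma tsum_res {N r : ℕ} (hN : 0 < N) (hr : 1 < r) (χ : ℤ → ℂ) (h : IsSymmetricFun N r χ) :
    ∑' n : ℤ, χ n / (n : ℂ) ^ r =
      ∑ a ∈ Finset.range N, χ (a : ℤ) * ∑' k : ℤ, 1 / ((a : ℂ) + k * N) ^ r := by
  have : NeZero N := ⟨hN.ne'⟩
  have hs := summ_f hN hr χ h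
  rw [← (Int.divModEquiv N).symm.tsum_eq]
  have hs' := (Int.divModEquiv N).symm.summable_iff.2 hs
  have hs'' := (Equiv.prodComm (Fin N) ℤ).summable_iff.2 hs'
  rw [← (Equiv.prodComm (Fin N) ℤ).tsum_eq]
  refine (hs''.tsum_prod).trans ?_
  rw [tsum_fintype, Finset.sum_range]
  refine Finset.sum_congr rfl fun a _ => ?_
  rw [← tsum_mul_left]
  refine tsum_congr fun k => ?_
  simp only [Function.comp, Equiv.prodComm_apply, Prod.swap, Int.divModEquiv_symm_apply]
  rw [chi_per χ h k a a.2]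
  push_cast
  rw [add_comm (a : ℂ)]
  ring

lemma tsum_refl (N p : ℕ) (a : ℕ) (ha : a ≤ N) :
    ∑' k : ℤ, 1 / (((N - a : ℕ) : ℂ) + k * N) ^ (2 * p + 1) =
      - ∑' k : ℤ, 1 / ((a : ℂ) + k * N) ^ (2 * p + 1) := by
  rw [← tsum_neg, ← (Equiv.subLeft (-1 : ℤ)).tsum_eq]
  refine tsum_congr fun k => ?_
  have : (((N - a : ℕ) : ℂ) + ((Equiv.subLeft (-1 : ℤ)) k : ℤ) * N) = - ((a : ℂ) + k * N) := by
    simp [Nat.cast_sub ha]; ring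
  rw [this, Odd.neg_pow ⟨p, rfl⟩]
  simp [div_neg]

lemma half_sum (q p : ℕ) (hq : 2 ≤ q) (χ : ℤ → ℂ)
    (hχ : IsSymmetricFun (2 * q) (2 * p + 1) χ) (S : ℕ → ℂ)
    (hS : ∀ a, a ≤ 2 * q → S (2 * q - a) = - S a) :
    ∑ a ∈ Finset.range (2 * q), χ (a : ℤ) * S a =
      2 * ∑ a ∈ Finset.Icc 1 (q - 1), χ (a : ℤ) * S a := by
  have h0 : χ 0 = 0 := by simpa using hχ.1 0
  have hg : ∀ a : ℕ, 1 ≤ a → a ≤ 2 * q - 1 →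
      χ ((2 * q - a : ℕ) : ℤ) * S (2 * q - a) = χ (a : ℤ) * S a := by
    intro a h1 h2
    have h3 := hχ.2.2 a h1 h2
    rw [Odd.neg_one_pow ⟨p, rfl⟩] at h3
    have e : (((2 * q - a : ℕ) : ℤ)) = ((2 * q : ℕ) : ℤ) - a := by
      rw [Nat.cast_sub (by omega)]
    rw [e, h3, hS a (by omega)]
    ring
  have hSq : S q = 0 := by
    have := hS q (by omega)
    rw [show 2 * q - q = q by omega] at this
    exact self_eq_neg.1 this
  obtain ⟨m, rfl⟩ : ∃ m, q = m + 1 := ⟨q - 1, by omega⟩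
  have hI : Finset.Icc 1 (m + 1 - 1) = Finset.Ico 1 (m + 1) := by
    ext; simp only [Finset.mem_Icc, Finset.mem_Ico]; omega
  rw [hI, Finset.range_eq_Ico, ← Finset.sum_Ico_consecutive _ (Nat.zero_le 1) (by omega),
    ← Finset.sum_Ico_consecutive _ (show 1 ≤ m + 1 by omega) (by omega),
    ← Finset.sum_Ico_consecutive _ (show m + 1 ≤ m + 2 by omega) (by omega)]
  have e2 : ∑ a ∈ Finset.Ico (m + 2) (2 * (m + 1)), χ (a : ℤ) * S a =
      ∑ a ∈ Finset.Ico 1 (m + 1), χ (a : ℤ) * S a := by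
    refine Finset.sum_bij' (fun a _ => 2 * (m + 1) - a) (fun a _ => 2 * (m + 1) - a) ?_ ?_ ?_ ?_ ?_
    · intro a ha; simp at ha ⊢; omega
    · intro a ha; simp at ha ⊢; omega
    · intro a ha; simp at ha ⊢; omega
    · intro a ha; simp at ha ⊢; omega
    · intro a ha
      simp at ha
      exact (hg a (by omega) (by omega)).symm
  rw [e2]
  simp [h0, hSq]
  ring

/-- Corollary 3.3: for `N = 2q`, `r = 2p+1` and a symmetric function `χ` mod `2q` of parity `r`,
`L(r,χ) = ((-1)^(p+1)/(r-1)!) · (π^r i / q^r) · Σ_(a=1)^(q-1) χ(a)·h_r(ζ_(2q)^a)`. -/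
theorem lseries_symmetricFun_odd_eq (q p : ℕ) (hq : 2 ≤ q) (hp : 1 ≤ p) (χ : ℤ → ℂ)
    (hχ : IsSymmetricFun (2 * q) (2 * p + 1) χ) :
    ∑' n : ℕ, χ (n + 1) / ((n : ℂ) + 1) ^ (2 * p + 1) =
      ((-1) ^ (p + 1) / (Nat.factorial (2 * p) : ℂ)) *
        ((Real.pi : ℂ) ^ (2 * p + 1) * Complex.I / (q : ℂ) ^ (2 * p + 1)) *
        ∑ a ∈ Finset.Icc 1 (q - 1),
          χ (a : ℤ) *
            auxH (2 * p + 1) (Complex.exp (2 * (Real.pi : ℂ) * Complex.I / (2 * (q : ℂ))) ^ a) := by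
  have hN : 0 < 2 * q := by omega
  have hr : 1 < 2 * p + 1 := by omega
  have hs := summ_f hN hr χ hχ
  have h0 : χ 0 = 0 := by simpa using hχ.1 0
  have hodd : Odd (2 * p + 1) := ⟨p, rfl⟩
  have heven : Function.Even (fun n : ℤ => χ n / (n : ℂ) ^ (2 * p + 1)) := by
    intro n
    simp only [chi_neg hN χ hχ n, Int.cast_neg, hodd.neg_pow, one_pow]
    rw [neg_one_mul, neg_div_neg_eq]
  have h1 := tsum_int_eq_zero_add_two_mul_tsum_pnat heven hs
  rw [tsum_res hN hr χ hχ, half_sum q p hq χ hχ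
    (fun a => ∑' k : ℤ, 1 / ((a : ℂ) + k * (2 * q : ℕ)) ^ (2 * p + 1))
    (fun a ha => tsum_refl (2 * q) p a ha)] at h1
  rw [h0, zero_div, zero_add, nsmul_eq_mul,
    tsum_pnat_eq_tsum_succ (f := fun n : ℕ => χ (n : ℤ) / (((n : ℤ) : ℂ)) ^ (2 * p + 1))] at h1
  have h2 := mul_left_cancel₀ (by norm_num) h1
  push_cast at h2
  rw [← h2, Finset.mul_sum]
  refine Finset.sum_congr rfl fun a ha => ?_
  rw [Finset.mem_Icc] at ha
  have hq0 : (q : ℂ) ≠ 0 := by exact_mod_cast (by omega : q ≠ 0)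
  have hqr : (q : ℝ) ≠ 0 := by exact_mod_cast (by omega : q ≠ 0)
  have hk := key p hp ((a : ℝ) / (2 * q)) (by
    intro n hn
    field_simp at hn
    have h3 : (a : ℤ) + 2 * q * n = 0 := by
      have : (a : ℝ) + 2 * q * n = 0 := by linarith
      exact_mod_cast this
    rcases le_or_gt 0 n with h | h
    · have : 0 ≤ 2 * (q : ℤ) * n := by positivity
      omega
    · have : 2 * (q : ℤ) * n ≤ 2 * (q : ℤ) * (-1) := by gcongr; omega
      omega)
  have e1 : Complex.exp (2 * (Real.pi : ℂ) * Complex.I / (2 * (q : ℂ))) ^ a =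
      Complex.exp (2 * (Real.pi : ℂ) * Complex.I * (((a : ℝ) / (2 * q) : ℝ) : ℂ)) := by
    rw [← Complex.exp_nat_mul]
    congr 1
    push_cast
    ring
  have e2 : ∑' n : ℤ, 1 / ((((a : ℝ) / (2 * q) : ℝ) : ℂ) + n) ^ (2 * p + 1) =
      (2 * (q : ℂ)) ^ (2 * p + 1) * ∑' k : ℤ, 1 / ((a : ℂ) + k * (2 * q)) ^ (2 * p + 1) := by
    rw [← tsum_mul_left]
    refine tsum_congr fun k => ?_
    have : ((((a : ℝ) / (2 * q) : ℝ) : ℂ) + k) = ((a : ℂ) + k * (2 * q)) / (2 * q) := by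
      push_cast
      field_simp
    rw [this, div_pow, one_div_div]
    ring
  rw [e1]
  rw [e2] at hk
  generalize auxH (2 * p + 1) _ = H at *
  generalize ∑' k : ℤ, 1 / ((a : ℂ) + k * (2 * q)) ^ (2 * p + 1) = T at *
  have hf : (Nat.factorial (2 * p) : ℂ) ≠ 0 := by exact_mod_cast Nat.factorial_ne_zero _
  have hI : Complex.I ^ (2 * p) = (-1) ^ p := by rw [pow_mul, Complex.I_sq]
  have hT : T = ((-1) ^ (p + 1) / (Nat.factorial (2 * p) : ℂ)) *
        ((Real.pi : ℂ) ^ (2 * p + 1) * Complex.I / (q : ℂ) ^ (2 * p + 1)) * H := by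
    have hc : (Nat.factorial (2 * p) : ℂ) * (2 * (q : ℂ)) ^ (2 * p + 1) ≠ 0 :=
      mul_ne_zero hf (pow_ne_zero _ (mul_ne_zero two_ne_zero hq0))
    apply mul_left_cancel₀ hc
    rw [mul_assoc, ← hk, mul_pow _ Complex.I, hI, Complex.div_I]
    have : (q : ℂ) ^ (2 * p + 1) ≠ 0 := pow_ne_zero _ hq0
    rw [mul_pow 2 (q : ℂ)]
    field_simp
    ring
  rw [hT]
  ring
end

section
/- The L-series L(3,χ_24) = Σ_{n=1}^∞ χ_24(n)/n³ = (1 + 1/2³ + ⋯ + 1/11³ − 1/13³ − ⋯ − 1/23³) + (1/25³ + ⋯ + 1/35³ − 1/37³ − ⋯ − 1/47³) + ⋯ equals (π³/62208)·[(2484 − 828√3)·√(2+√3) + 54√2 + 20√3 + 261]. -/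
/-- The symmetric function `χ_{2m}` mod `2m`: value `1` on residues `1,…,m-1`,
`0` on residues `0` and `m`, and `-1` on residues `m+1,…,2m-1`. -/
noncomputable def chi2m (m : ℕ) : ℤ → ℂ := fun n =>
  let a := n % (2 * m)
  if a = 0 then 0
  else if a < m then 1
  else if a = m then 0
  else -1

theorem aux_base (r : ℕ) (hr : r ≤ 6) : Real.sin (r * Real.pi / 12) =
    if r = 0 then 0 else if r = 1 then √2 * (√3 - 1) / 4 else if r = 2 then 1/2
    else if r = 3 then √2 / 2 else if r = 4 then √3 / 2
    else if r = 5 then √2 * (√3 + 1) / 4 else 1 := by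
  have e1 : Real.pi / 12 = Real.pi / 3 - Real.pi / 4 := by ring
  have e5 : 5 * Real.pi / 12 = Real.pi / 4 + Real.pi / 6 := by ring
  have e2 : 2 * Real.pi / 12 = Real.pi / 6 := by ring
  have e3 : 3 * Real.pi / 12 = Real.pi / 4 := by ring
  have e4 : 4 * Real.pi / 12 = Real.pi / 3 := by ring
  have e6 : 6 * Real.pi / 12 = Real.pi / 2 := by ring
  interval_cases r
  · simp
  · norm_num [e1, Real.sin_sub]; ring
  · norm_num [e2]
  · norm_num [e3]
  · norm_num [e4]
  · norm_num [e5, Real.sin_add]; ring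
  · norm_num [e6]

noncomputable def auxT (r : ℕ) : ℝ :=
  match r with
  | 0 => 0 | 1 => √2 * (√3 - 1) / 4 | 2 => 1/2 | 3 => √2 / 2 | 4 => √3 / 2
  | 5 => √2 * (√3 + 1) / 4 | 6 => 1
  | 7 => √2 * (√3 + 1) / 4 | 8 => √3 / 2 | 9 => √2 / 2 | 10 => 1/2
  | 11 => √2 * (√3 - 1) / 4 | 12 => 0
  | 13 => -(√2 * (√3 - 1) / 4) | 14 => -(1/2) | 15 => -(√2 / 2) | 16 => -(√3 / 2)
  | 17 => -(√2 * (√3 + 1) / 4) | 18 => -1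
  | 19 => -(√2 * (√3 + 1) / 4) | 20 => -(√3 / 2) | 21 => -(√2 / 2) | 22 => -(1/2)
  | 23 => -(√2 * (√3 - 1) / 4) | _ => 0

theorem aux_half (r : ℕ) (hr : r ≤ 12) : Real.sin (r * Real.pi / 12) = auxT r := by
  rcases le_or_gt r 6 with h | h
  · rw [aux_base r h]
    interval_cases r <;> simp [auxT]
  · have : (r : ℝ) * Real.pi / 12 = Real.pi - ((12 - r : ℕ) : ℝ) * Real.pi / 12 := by
      rw [Nat.cast_sub hr]; push_cast; ring
    rw [this, Real.sin_pi_sub, aux_base _ (by omega)]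
    interval_cases r <;> simp [auxT]

theorem aux_full (r : ℕ) (hr : r < 24) : Real.sin (r * Real.pi / 12) = auxT r := by
  rcases le_or_gt r 12 with h | h
  · exact aux_half r h
  · have : (r : ℝ) * Real.pi / 12 = ((r - 12 : ℕ) : ℝ) * Real.pi / 12 + Real.pi := by
      rw [Nat.cast_sub h.le]; push_cast; ring
    rw [this, Real.sin_add_pi, aux_half _ (by omega)]
    interval_cases r <;> simp [auxT]

theorem aux_sin (n j : ℕ) : Real.sin (2 * Real.pi * n * ((j : ℝ) / 24)) = auxT (n % 24 * j % 24) := by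
  rw [← aux_full _ (Nat.mod_lt _ (by norm_num)), Nat.mod_mul_mod]
  have h : ((n * j : ℕ) : ℝ) = ((24 * (n * j / 24) + n * j % 24 : ℕ) : ℝ) := by
    rw [Nat.div_add_mod]
  have e : 2 * Real.pi * n * ((j : ℝ) / 24)
      = ((n * j % 24 : ℕ) : ℝ) * Real.pi / 12 + (n * j / 24 : ℕ) * (2 * Real.pi) := by
    push_cast at h ⊢
    linear_combination Real.pi / 12 * h
  rw [e, Real.sin_add_nat_mul_two_pi]

noncomputable def auxX (r : ℕ) : ℝ := if r = 0 then 0 else if r < 12 then 1 else if r = 12 then 0 else -1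

theorem aux_chi (n : ℕ) : chi2m 12 n = ((auxX (n % 24) : ℝ) : ℂ) := by
  have h : ((n : ℤ) % (2 * ((12 : ℕ) : ℤ))) = ((n % 24 : ℕ) : ℤ) := by push_cast; norm_num
  unfold chi2m
  simp only [h]
  have : n % 24 < 24 := Nat.mod_lt _ (by norm_num)
  generalize n % 24 = r at *
  interval_cases r <;> simp [auxX]

theorem aux_dft (r : ℕ) (hr : r < 24) :
    (2+√2+√3+√2*√3) * auxT (r * 1 % 24) + (1+√2) * auxT (r * 3 % 24)
    + (2-√2-√3+√2*√3) * auxT (r * 5 % 24) + (-2-√2+√3+√2*√3) * auxT (r * 7 % 24)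
    + (√2-1) * auxT (r * 9 % 24) + (-2+√2-√3+√2*√3) * auxT (r * 11 % 24) = 6 * auxX r := by
  have ha : √2 * √2 = (2:ℝ) := by norm_num
  have hb : √3 * √3 = (3:ℝ) := by norm_num
  interval_cases r <;> norm_num [auxT, auxX] <;> grind

theorem aux_bern (x : ℚ) :
    (Polynomial.map (algebraMap ℚ ℝ) (Polynomial.bernoulli 3)).eval (x : ℝ)
      = ((x ^ 3 - 3 / 2 * x ^ 2 + x / 2 : ℚ) : ℝ) := by
  have : (x : ℝ) = (algebraMap ℚ ℝ) x := by simp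
  rw [this, Polynomial.eval_map_algebraMap, Polynomial.aeval_algebraMap_apply]
  have h : Polynomial.aeval x (Polynomial.bernoulli 3) = x ^ 3 - 3 / 2 * x ^ 2 + x / 2 := by
    rw [Polynomial.bernoulli]
    simp [Finset.sum_range_succ, bernoulli_eq_bernoulli'_of_ne_one, bernoulli_one, bernoulli'_two,
      bernoulli'_three, Nat.choose]
    ring
  rw [h]; simp

theorem aux_sum (j : ℕ) (hj : j ≤ 24) :
    HasSum (fun n : ℕ => 1 / (n : ℝ) ^ 3 * auxT (n % 24 * j % 24))
      (2 * Real.pi ^ 3 / 3 * (((j : ℝ) / 24) ^ 3 - 3 / 2 * ((j : ℝ) / 24) ^ 2 + (j : ℝ) / 24 / 2)) := by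
  have hx : ((j : ℝ) / 24) ∈ Set.Icc (0 : ℝ) 1 :=
    ⟨by positivity, by rw [div_le_one (by norm_num)]; exact_mod_cast hj⟩
  have := hasSum_one_div_nat_pow_mul_sin one_ne_zero hx
  simp only [aux_sin] at this
  have hb := aux_bern ((j : ℚ) / 24)
  push_cast at hb
  norm_num only [hb, Nat.factorial] at this
  convert this using 1
  ring

/-- `L(3,χ_24) = Σ_(n=1)^∞ χ_24(n)/n^3` evaluated in closed form. -/
theorem lseries_chi24_three :
    ∑' n : ℕ, chi2m 12 (n + 1) / ((n : ℂ) + 1) ^ 3 =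
      ((Real.pi ^ 3 / 62208 * ((2484 - 828 * Real.sqrt 3) * Real.sqrt (2 + Real.sqrt 3) + 54 * Real.sqrt 2 + 20 * Real.sqrt 3 + 261) : ℝ) : ℂ) := by
  have ha : √2 * √2 = (2:ℝ) := by norm_num
  have hb : √3 * √3 = (3:ℝ) := by norm_num
  have hs : √(2 + √3) = √2 * (√3 + 1) / 2 := by
    rw [Real.sqrt_eq_iff_mul_self_eq (by positivity) (by positivity)]
    grind
  have H := ((((((aux_sum 1 (by norm_num)).mul_left (2+√2+√3+√2*√3)).add
    ((aux_sum 3 (by norm_num)).mul_left (1+√2))).add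
    ((aux_sum 5 (by norm_num)).mul_left (2-√2-√3+√2*√3))).add
    ((aux_sum 7 (by norm_num)).mul_left (-2-√2+√3+√2*√3))).add
    ((aux_sum 9 (by norm_num)).mul_left (√2-1))).add
    ((aux_sum 11 (by norm_num)).mul_left (-2+√2-√3+√2*√3))
  have H2 : HasSum (fun n : ℕ => auxX (n % 24) / (n : ℝ) ^ 3) (Real.pi ^ 3 / 62208 * ((2484 - 828 * Real.sqrt 3) * Real.sqrt (2 + Real.sqrt 3) + 54 * Real.sqrt 2 + 20 * Real.sqrt 3 + 261)) := by
    have H1 := H.mul_left (1 / 6)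
    refine (congr_arg₂ HasSum ?_ ?_).to_iff.mp H1
    · funext n
      have := aux_dft (n % 24) (Nat.mod_lt _ (by norm_num))
      linear_combination (1 / 6 / (n : ℝ) ^ 3) * this
    · rw [hs]
      push_cast
      grind
  have H3 := (hasSum_nat_add_iff' 1).mpr H2
  have H4 := Complex.hasSum_ofReal.mpr H3
  simp only [Finset.sum_range_one] at H4
  rw [show auxX (0 % 24) = 0 by simp [auxX]] at H4
  simp only [zero_div, sub_zero] at H4
  rw [← H4.tsum_eq]
  congr 1
  ext n
  have := aux_chi (n + 1)
  push_cast at this ⊢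
  rw [this]
end

section
/- The L-series L(5,χ_12) = Σ_{n=1}^∞ χ_12(n)/n⁵ = (1 + 1/2⁵ + ⋯ + 1/5⁵ − 1/7⁵ − ⋯ − 1/11⁵) + (1/13⁵ + ⋯ + 1/17⁵ − 1/19⁵ − ⋯ − 1/23⁵) + ⋯ equals π⁵(3675 + 68√3)/1119744. -/
noncomputable def sTab (n : ℕ) : ℝ := Real.sin (Real.pi * n / 6)

lemma sTab_add6 (n : ℕ) : sTab (n + 6) = - sTab n := by
  unfold sTab
  rw [← Real.sin_add_pi]
  congr 1
  push_cast
  ring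

lemma sTab_add12 (n q : ℕ) : sTab (n + 12 * q) = sTab n := by
  induction q with
  | zero => simp
  | succ q ih =>
    have : n + 12 * (q + 1) = (n + 12 * q) + 6 + 6 := by ring
    rw [this, sTab_add6, sTab_add6, neg_neg, ih]

lemma sTab_mod (n : ℕ) : sTab n = sTab (n % 12) := by
  conv_lhs => rw [← Nat.mod_add_div n 12]
  exact sTab_add12 _ _

lemma sTab0 : sTab 0 = 0 := by simp [sTab]
lemma sTab1 : sTab 1 = 1 / 2 := by simp [sTab]
lemma sTab2 : sTab 2 = Real.sqrt 3 / 2 := by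
  unfold sTab
  rw [← Real.sin_pi_div_three]
  congr 1
  push_cast
  ring
lemma sTab3 : sTab 3 = 1 := by
  unfold sTab
  rw [← Real.sin_pi_div_two]
  congr 1
  push_cast
  ring
lemma sTab4 : sTab 4 = Real.sqrt 3 / 2 := by
  unfold sTab
  rw [← Real.sin_pi_div_three, ← Real.sin_pi_sub]
  congr 1
  push_cast
  ring
lemma sTab5 : sTab 5 = 1 / 2 := by
  unfold sTab
  rw [← Real.sin_pi_div_six, ← Real.sin_pi_sub]
  congr 1
  push_cast
  ring
lemma sTab6 : sTab 6 = 0 := by rw [sTab_add6 0, sTab0]; simp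
lemma sTab7 : sTab 7 = -(1 / 2) := by rw [sTab_add6 1, sTab1]
lemma sTab8 : sTab 8 = -(Real.sqrt 3 / 2) := by rw [sTab_add6 2, sTab2]
lemma sTab9 : sTab 9 = -1 := by rw [sTab_add6 3, sTab3]
lemma sTab10 : sTab 10 = -(Real.sqrt 3 / 2) := by rw [sTab_add6 4, sTab4]
lemma sTab11 : sTab 11 = -(1 / 2) := by rw [sTab_add6 5, sTab5]

lemma chi_eq (n : ℕ) : chi2m 6 (n : ℤ) =
    (((2 + Real.sqrt 3) / 3 * sTab n + 1 / 3 * sTab (3 * n)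
      + (2 - Real.sqrt 3) / 3 * sTab (5 * n) : ℝ) : ℂ) := by
  have h3 : Real.sqrt 3 * Real.sqrt 3 = 3 := Real.mul_self_sqrt (by norm_num)
  have hs : sTab (3 * n) = sTab (3 * (n % 12) % 12) := by
    rw [sTab_mod]; congr 1; omega
  have hs5 : sTab (5 * n) = sTab (5 * (n % 12) % 12) := by
    rw [sTab_mod]; congr 1; omega
  have hc : chi2m 6 (n : ℤ) = chi2m 6 ((n % 12 : ℕ) : ℤ) := by
    unfold chi2m
    have : (n : ℤ) % (2 * (6 : ℕ)) = ((n % 12 : ℕ) : ℤ) % (2 * (6 : ℕ)) := by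
      push_cast; omega
    simp only [this]
  rw [hc, hs, hs5, sTab_mod n]
  have hr : n % 12 < 12 := Nat.mod_lt _ (by norm_num)
  generalize n % 12 = r at hr
  have key : ∀ z : ℝ, ∀ w : ℂ, w = ((z : ℝ) : ℂ) →
    z = ((2 + Real.sqrt 3) / 3 * sTab r + 1 / 3 * sTab (3 * r % 12)
      + (2 - Real.sqrt 3) / 3 * sTab (5 * r % 12)) →
    w = (((2 + Real.sqrt 3) / 3 * sTab r + 1 / 3 * sTab (3 * r % 12)
      + (2 - Real.sqrt 3) / 3 * sTab (5 * r % 12) : ℝ) : ℂ) := by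
    intro z w h1 h2
    rw [h1, h2]
  apply key (if r = 0 then 0 else if r < 6 then 1 else if r = 6 then 0 else -1)
  · interval_cases r <;> norm_num [chi2m]
  · interval_cases r <;>
      norm_num [sTab0, sTab1, sTab2, sTab3, sTab4, sTab5, sTab6, sTab7, sTab8, sTab9,
        sTab10, sTab11] <;> nlinarith [h3]

lemma b5 (x : ℝ) : (Polynomial.map (algebraMap ℚ ℝ) (Polynomial.bernoulli 5)).eval x =
    x ^ 5 - 5 / 2 * x ^ 4 + 5 / 3 * x ^ 3 - x / 6 := by
  have h3 : bernoulli 3 = 0 := by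
    rw [bernoulli_eq_bernoulli'_of_ne_one (by norm_num), bernoulli'_three]
  have h4 : bernoulli 4 = -1 / 30 := by
    rw [bernoulli_eq_bernoulli'_of_ne_one (by norm_num), bernoulli'_four]
  have h5 : bernoulli 5 = 0 := by
    rw [bernoulli_eq_bernoulli'_of_ne_one (by norm_num)]
    exact bernoulli'_eq_zero_of_odd (by decide) (by norm_num)
  have c1 : Nat.choose 5 2 = 10 := by decide
  have c2 : Nat.choose 5 3 = 10 := by decide
  simp [Polynomial.bernoulli, Finset.sum_range_succ, h3, h4, h5, bernoulli_one, bernoulli_two,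
    bernoulli_zero, c1, c2, Polynomial.eval_add, Polynomial.map_add]
  ring

lemma hs (j : ℕ) (hj : j ≤ 12) : HasSum (fun n : ℕ => 1 / (n : ℝ) ^ 5 * sTab (j * n))
    (-(2 * Real.pi) ^ 5 / 240 * (((j : ℝ) / 12) ^ 5 - 5 / 2 * ((j : ℝ) / 12) ^ 4
      + 5 / 3 * ((j : ℝ) / 12) ^ 3 - ((j : ℝ) / 12) / 6)) := by
  have hj' : (j : ℝ) ≤ 12 := by exact_mod_cast hj
  have h := hasSum_one_div_nat_pow_mul_sin (k := 2) (by norm_num) (x := (j : ℝ) / 12)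
    ⟨by positivity, by linarith⟩
  rw [show 2 * 2 + 1 = 5 from rfl, b5] at h
  convert h using 1
  · funext n
    unfold sTab
    congr 2
    push_cast
    ring
  · have hf : ((Nat.factorial 5 : ℕ) : ℝ) = 120 := by norm_num [Nat.factorial]
    rw [hf]
    ring

/-- `L(5,χ_12) = Σ_(n=1)^∞ χ_12(n)/n^5` evaluated in closed form. -/
theorem lseries_chi12_five :
    ∑' n : ℕ, chi2m 6 (n + 1) / ((n : ℂ) + 1) ^ 5 =
      ((Real.pi ^ 5 * (3675 + 68 * Real.sqrt 3) / 1119744 : ℝ) : ℂ) := by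
  have h3 : Real.sqrt 3 * Real.sqrt 3 = 3 := Real.mul_self_sqrt (by norm_num)
  have H := (((hs 1 (by norm_num)).mul_left ((2 + Real.sqrt 3) / 3)).add
    ((hs 3 (by norm_num)).mul_left (1 / 3))).add
    ((hs 5 (by norm_num)).mul_left ((2 - Real.sqrt 3) / 3))
  have H2 := (hasSum_nat_add_iff' 1).mpr H
  have H3 := Complex.hasSum_ofReal.mpr H2
  have H4 := H3.tsum_eq
  convert H4 using 1
  · congr 1
    funext n
    have := chi_eq (n + 1)
    push_cast at this ⊢
    rw [this]
    simp only [one_mul]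
    ring
  · congr 1
    simp [sTab0]
    ring_nf
    try nlinarith [h3]
end
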